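/- Let q ≥ 1 with Hölder conjugate p (1/p + 1/q = 1, with p = ∞ when q = 1), let R_1,…,R_n ∈ ℝ^d, let δ > 0, and let φ ∈ ℝ^d with Σ_{i=1}^d φ_i = 1. Then sup { Var_P(⟨φ,R⟩) : P a Borel probability measure on ℝ^d with finite second moments, D_c(P,P_n) ≤ δ } = ( √( Var_{P_n}(⟨φ,R⟩) ) + √δ ‖φ‖_p )², where Var_P(⟨φ,R⟩) = E_P[⟨φ,R⟩²] − (E_P[⟨φ,R⟩])². -/

import Mathlib

open MeasureTheory ENNReal NNReal Filter Topology

noncomputable section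

/-- The `l_p` norm on `ℝ^d`, for an extended exponent `p` (sup-norm when `p = ∞`). -/
def lpNorm {d : ℕ} (p : ℝ≥0∞) (x : Fin d → ℝ) : ℝ :=
  if p = ∞ then ⨆ i, |x i| else (∑ i, |x i| ^ p.toReal) ^ (1 / p.toReal)

/-- `p ∈ [1,∞]` is the Hölder conjugate of `q ∈ [1,∞)`: `1/p + 1/q = 1`,
with `p = ∞` when `q = 1`. -/
def HolderConjugate (q : ℝ) (p : ℝ≥0∞) : Prop :=
  (q = 1 ∧ p = ∞) ∨ (1 < q ∧ p ≠ ∞ ∧ 1 / p.toReal + 1 / q = 1)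

/-- The optimal transport discrepancy between two Borel probability measures on `ℝ^d`
associated with a cost function `c`. -/
def Dc {d : ℕ} (c : (Fin d → ℝ) → (Fin d → ℝ) → ℝ≥0∞)
    (P Q : Measure (Fin d → ℝ)) : ℝ≥0∞ :=
  ⨅ (π : Measure ((Fin d → ℝ) × (Fin d → ℝ))) (_ : IsProbabilityMeasure π)
    (_ : π.map Prod.fst = P) (_ : π.map Prod.snd = Q), ∫⁻ x, c x.1 x.2 ∂π

/-- The quadratic `l_q` transport cost `c(u,w) = ‖u - w‖_q²`. -/
def costQ {d : ℕ} (q : ℝ) (u w : Fin d → ℝ) : ℝ≥0∞ :=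
  ENNReal.ofReal (lpNorm (ENNReal.ofReal q) (u - w) ^ 2)

/-- The empirical measure `P_n = (1/n) ∑_{i=1}^n δ_{R_i}`. -/
def empMeasure {d n : ℕ} (R : Fin n → Fin d → ℝ) : Measure (Fin d → ℝ) :=
  (n : ℝ≥0∞)⁻¹ • ∑ i : Fin n, Measure.dirac (R i)

/-- Weak convergence of a sequence of measures, expressed via integration of
bounded continuous functions. -/
def WeakConv {E : Type*} [TopologicalSpace E] [MeasurableSpace E]
    (μs : ℕ → Measure E) (ν : Measure E) : Prop :=
  ∀ f : BoundedContinuousFunction E ℝ,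
    Tendsto (fun n => ∫ x, f x ∂(μs n)) atTop (𝓝 (∫ x, f x ∂ν))

/-! ### The `l_p` norms -/

lemma lpNorm_nonneg {d : ℕ} (p : ℝ≥0∞) (x : Fin d → ℝ) : 0 ≤ lpNorm p x := by
  unfold _root_.lpNorm
  split_ifs
  · exact Real.iSup_nonneg fun i => abs_nonneg _
  · positivity

lemma lpNorm_ofReal {d : ℕ} {q : ℝ} (hq : 0 ≤ q) (x : Fin d → ℝ) :
    lpNorm (ENNReal.ofReal q) x = (∑ i, |x i| ^ q) ^ (1 / q) := by
  simp [_root_.lpNorm, ENNReal.toReal_ofReal hq]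

lemma lpNorm_smul {d : ℕ} {q : ℝ} (hq : 0 < q) (a : ℝ) (x : Fin d → ℝ) :
    lpNorm (ENNReal.ofReal q) (a • x) = |a| * lpNorm (ENNReal.ofReal q) x := by
  rw [lpNorm_ofReal hq.le, lpNorm_ofReal hq.le]
  simp only [Pi.smul_apply, smul_eq_mul, abs_mul]
  simp_rw [Real.mul_rpow (abs_nonneg _) (abs_nonneg _), ← Finset.mul_sum]
  rw [Real.mul_rpow (by positivity) (by positivity), ← Real.rpow_mul (abs_nonneg _),
    mul_one_div_cancel hq.ne', Real.rpow_one]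

lemma HolderConjugate.real {q : ℝ} {p : ℝ≥0∞} (hq : 1 < q)
    (h : 1 / p.toReal + 1 / q = 1) : p.toReal.HolderConjugate q := by
  have h' : q.HolderConjugate p.toReal :=
    (Real.holderConjugate_iff).2 ⟨hq, by simpa [add_comm] using h⟩
  exact h'.symm

/-- Hölder's inequality for the pair `lpNorm p`, `lpNorm q`. -/
lemma abs_sum_mul_le_lpNorm {d : ℕ} {q : ℝ} {p : ℝ≥0∞} (hpq : HolderConjugate q p)
    (φ x : Fin d → ℝ) :
    |∑ i, φ i * x i| ≤ lpNorm p φ * lpNorm (ENNReal.ofReal q) x := by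
  refine (Finset.abs_sum_le_sum_abs _ _).trans ?_
  simp only [abs_mul]
  rcases hpq with ⟨rfl, rfl⟩ | ⟨hq, hp, h⟩
  · rw [lpNorm_ofReal zero_le_one]
    simp only [_root_.lpNorm, if_true, Real.rpow_one, div_one, Finset.mul_sum]
    gcongr with i
    exact le_ciSup (f := fun i => |φ i|) (Set.finite_range _).bddAbove i
  · rw [lpNorm_ofReal (by linarith), _root_.lpNorm, if_neg hp]
    simpa using Real.inner_le_Lp_mul_Lq Finset.univ (fun i => |φ i|) (fun i => |x i|)
      (HolderConjugate.real hq h)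

/-- Hölder's inequality is attained on the unit ball of the `l_q` norm. -/
lemma exists_lpNorm_le_one_sum_mul_eq {d : ℕ} {q : ℝ} {p : ℝ≥0∞} (hpq : HolderConjugate q p)
    (φ : Fin d → ℝ) :
    ∃ v : Fin d → ℝ, lpNorm (ENNReal.ofReal q) v ≤ 1 ∧ ∑ i, φ i * v i = lpNorm p φ := by
  rcases hpq with ⟨rfl, rfl⟩ | ⟨hq, hp, h⟩
  · rcases isEmpty_or_nonempty (Fin d) with hd | hd
    · exact ⟨0, by rw [lpNorm_ofReal zero_le_one]; simp, by simp [_root_.lpNorm]⟩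
    · obtain ⟨j, hj⟩ := exists_eq_ciSup_of_finite (f := fun i => |φ i|)
      refine ⟨Pi.single j (SignType.sign (φ j) : ℝ), ?_, ?_⟩
      · rw [lpNorm_ofReal zero_le_one]
        simp only [Real.rpow_one, div_one]
        rw [Finset.sum_eq_single j (fun i _ hi => by simp [hi]) (by simp)]
        rcases lt_trichotomy (φ j) 0 with h | h | h <;> simp [h]
      · rw [Finset.sum_eq_single j (fun i _ hi => by simp [hi]) (by simp)]
        simp [_root_.lpNorm, ← hj]
  · obtain ⟨g, hg, hg'⟩ := (NNReal.isGreatest_Lp Finset.univ (fun i => ‖φ i‖₊)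
      (HolderConjugate.real hq h)).1
    have hg1 : ∑ i, (g i : ℝ) ^ q ≤ 1 := by exact_mod_cast hg
    refine ⟨fun i => SignType.sign (φ i) * g i, ?_, ?_⟩
    · rw [lpNorm_ofReal (by linarith)]
      refine Real.rpow_le_one (by positivity) (le_trans ?_ hg1) (by positivity)
      gcongr with i
      rw [abs_mul, NNReal.abs_eq]
      refine mul_le_of_le_one_left (g i).2 ?_
      rcases lt_trichotomy (φ i) 0 with h | h | h <;> simp [h]
    · have := congrArg ((↑) : ℝ≥0 → ℝ) hg'
      push_cast at this
      rw [_root_.lpNorm, if_neg hp]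
      simpa [← mul_assoc] using this

/-! ### Standard deviation -/

open ProbabilityTheory in
/-- The standard deviation satisfies the triangle inequality. -/
lemma sqrt_variance_add_le {Ω : Type*} [MeasurableSpace Ω] {μ : Measure Ω} [IsFiniteMeasure μ]
    {X Y : Ω → ℝ} (hX : MemLp X 2 μ) (hY : MemLp Y 2 μ) :
    √(Var[X + Y; μ]) ≤ √(Var[X; μ]) + √(Var[Y; μ]) := by
  have hcov : cov[X, Y; μ] ^ 2 ≤ Var[X; μ] * Var[Y; μ] := by
    have h := discrim_le_zero (a := Var[Y; μ]) (b := 2 * cov[X, Y; μ]) (c := Var[X; μ])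
      fun t => by
        have h := variance_nonneg (X + t • Y) μ
        rw [variance_add hX (hY.const_smul t), covariance_smul_right, variance_smul] at h
        linarith
    rw [discrim] at h
    linarith
  have hX0 := variance_nonneg X μ
  have hY0 := variance_nonneg Y μ
  have hle : cov[X, Y; μ] ≤ √(Var[X; μ]) * √(Var[Y; μ]) := by
    rw [← Real.sqrt_mul hX0]
    exact Real.le_sqrt_of_sq_le hcov
  refine Real.sqrt_le_iff.2 ⟨by positivity, ?_⟩
  rw [variance_add hX hY]
  nlinarith [Real.sq_sqrt hX0, Real.sq_sqrt hY0]

/-! ### Uniform measures on finite families -/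

/-- The uniform probability measure on a finite family of points. -/
def uniformFamily {ι E : Type*} [Fintype ι] [MeasurableSpace E] (f : ι → E) : Measure E :=
  (Fintype.card ι : ℝ≥0∞)⁻¹ • ∑ i, Measure.dirac (f i)

section uniformFamily

variable {ι E F : Type*} [Fintype ι] [MeasurableSpace E] [MeasurableSpace F]

lemma empMeasure_eq_uniformFamily {d n : ℕ} (R : Fin n → Fin d → ℝ) :
    empMeasure R = uniformFamily R := by
  simp [empMeasure, uniformFamily]

lemma isProbabilityMeasure_uniformFamily [Nonempty ι] (f : ι → E) :
    IsProbabilityMeasure (uniformFamily f) := by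
  refine ⟨?_⟩
  simp [uniformFamily, ENNReal.inv_mul_cancel]

lemma map_uniformFamily {g : E → F} (hg : Measurable g) (f : ι → E) :
    (uniformFamily f).map g = uniformFamily (g ∘ f) := by
  simp only [uniformFamily, Measure.map_smul, Measure.map_finset_sum' hg.aemeasurable,
    Measure.map_dirac' hg, Function.comp_apply]

lemma uniformFamily_comp_fst {κ : Type*} [Fintype κ] [Nonempty κ] (f : ι → E) :
    uniformFamily (fun k : ι × κ => f k.1) = uniformFamily f := by
  have h0 : (Fintype.card κ : ℝ≥0∞) ≠ 0 := by simp
  simp only [uniformFamily, Fintype.sum_prod_type, Finset.sum_const, Finset.card_univ,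
    Fintype.card_prod, Nat.cast_mul, ← Finset.smul_sum]
  rw [← Nat.cast_smul_eq_nsmul ℝ≥0∞, smul_smul,
    ENNReal.mul_inv (Or.inr (by simp)) (Or.inl (by simp)), mul_assoc,
    ENNReal.inv_mul_cancel h0 (by simp), mul_one]

variable [MeasurableSingletonClass E]

lemma integrable_uniformFamily [Nonempty ι] (f : ι → E) (g : E → ℝ) :
    Integrable g (uniformFamily f) := by
  refine Integrable.smul_measure ?_ (by simp)
  exact integrable_finsetSum_measure.2 fun i _ => integrable_dirac (by simp)

lemma integral_uniformFamily (f : ι → E) (g : E → ℝ) :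
    ∫ x, g x ∂(uniformFamily f) = (1 / Fintype.card ι : ℝ) * ∑ i, g (f i) := by
  rw [uniformFamily, integral_smul_measure,
    integral_finsetSum_measure fun i _ => integrable_dirac (by simp)]
  simp

end uniformFamily

/-! ### The worst-case variance -/

lemma memLp_two_sum_mul {d : ℕ} (φ : Fin d → ℝ) {P : Measure (Fin d → ℝ)}
    (hP : Integrable (fun r => ‖r‖ ^ 2) P) : MemLp (fun r => ∑ i, φ i * r i) 2 P := by
  have h : MemLp (fun r : Fin d → ℝ => r) 2 P :=
    (memLp_two_iff_integrable_sq_norm aestronglyMeasurable_id).2 hP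
  exact memLp_finsetSum _ fun i _ => (h.eval i).const_mul _

open ProbabilityTheory in
/-- A coupling of `P` and `Q` of finite cost bounds the standard deviation of `⟨φ, ·⟩`
under `P` by that under `Q`. -/
lemma sqrt_variance_le_of_coupling {d : ℕ} {q : ℝ} {p : ℝ≥0∞} (hpq : HolderConjugate q p)
    (φ : Fin d → ℝ) {π : Measure ((Fin d → ℝ) × (Fin d → ℝ))} [IsProbabilityMeasure π]
    (h1 : Integrable (fun r => ‖r‖ ^ 2) (π.map Prod.fst))
    (h2 : Integrable (fun r => ‖r‖ ^ 2) (π.map Prod.snd)) {ε : ℝ} (hε : 0 ≤ ε)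
    (hcost : ∫⁻ x, costQ q x.1 x.2 ∂π ≤ ENNReal.ofReal ε) :
    √(Var[fun r => ∑ i, φ i * r i; π.map Prod.fst]) ≤
      √(Var[fun r => ∑ i, φ i * r i; π.map Prod.snd]) + √ε * lpNorm p φ := by
  set L : (Fin d → ℝ) → ℝ := fun r => ∑ i, φ i * r i with hL
  have hLm : Measurable L := by fun_prop
  have hX : MemLp (L ∘ Prod.fst) 2 π :=
    (memLp_two_sum_mul φ h1).comp_of_map measurable_fst.aemeasurable
  have hY : MemLp (L ∘ Prod.snd) 2 π :=
    (memLp_two_sum_mul φ h2).comp_of_map measurable_snd.aemeasurable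
  have hD := hX.sub hY
  rw [variance_map hLm.aemeasurable measurable_fst.aemeasurable,
    variance_map hLm.aemeasurable measurable_snd.aemeasurable]
  have htri := sqrt_variance_add_le hY hD
  rw [add_sub_cancel] at htri
  refine htri.trans ?_
  gcongr
  have hC := lpNorm_nonneg p φ
  have hint : ∫ x, (L x.1 - L x.2) ^ 2 ∂π ≤ lpNorm p φ ^ 2 * ε := by
    rw [integral_eq_lintegral_of_nonneg_ae (ae_of_all _ fun x => sq_nonneg _)
      (by fun_prop)]
    refine ENNReal.toReal_le_of_le_ofReal (by positivity) ?_
    rw [ENNReal.ofReal_mul (by positivity)]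
    refine le_trans ?_ (mul_le_mul_right hcost (ENNReal.ofReal (lpNorm p φ ^ 2)))
    rw [← lintegral_const_mul' _ _ ENNReal.ofReal_ne_top]
    refine lintegral_mono fun x => ?_
    rw [costQ, ← ENNReal.ofReal_mul (by positivity), ← mul_pow]
    refine ENNReal.ofReal_le_ofReal (sq_le_sq' ?_ ?_)
    all_goals
      have h := abs_le.1 (abs_sum_mul_le_lpNorm hpq φ (x.1 - x.2))
      simp only [Pi.sub_apply, mul_sub, Finset.sum_sub_distrib] at h
      simp only [hL]
      linarith [h.1, h.2]
  calc √(Var[L ∘ Prod.fst - L ∘ Prod.snd; π])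
      ≤ √(lpNorm p φ ^ 2 * ε) :=
        Real.sqrt_le_sqrt ((variance_le_expectation_sq hD.1).trans hint)
    _ = √ε * lpNorm p φ := by rw [Real.sqrt_mul (by positivity), Real.sqrt_sq hC, mul_comm]

open ProbabilityTheory in
/-- Upper bound on the standard deviation of `⟨φ, ·⟩` over a Wasserstein ball. -/
lemma sqrt_variance_le_of_Dc_le {d : ℕ} {q : ℝ} {p : ℝ≥0∞} (hpq : HolderConjugate q p)
    (φ : Fin d → ℝ) {P Q : Measure (Fin d → ℝ)}
    (hP : Integrable (fun r => ‖r‖ ^ 2) P) (hQ : Integrable (fun r => ‖r‖ ^ 2) Q)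
    {δ : ℝ} (hδ : 0 ≤ δ) (h : Dc (costQ q) P Q ≤ ENNReal.ofReal δ) :
    √(Var[fun r => ∑ i, φ i * r i; P]) ≤
      √(Var[fun r => ∑ i, φ i * r i; Q]) + √δ * lpNorm p φ := by
  have key : ∀ ε > δ, √(Var[fun r => ∑ i, φ i * r i; P]) ≤
      √(Var[fun r => ∑ i, φ i * r i; Q]) + √ε * lpNorm p φ := by
    intro ε hε
    have hlt := h.trans_lt ((ENNReal.ofReal_lt_ofReal_iff (hδ.trans_lt hε)).2 hε)
    simp only [Dc, iInf_lt_iff] at hlt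
    obtain ⟨π, hπ, rfl, rfl, hcost⟩ := hlt
    exact sqrt_variance_le_of_coupling hpq φ hP hQ (hδ.trans hε.le) hcost.le
  have hcont : Continuous fun ε : ℝ =>
      √(Var[fun r => ∑ i, φ i * r i; Q]) + √ε * lpNorm p φ := by fun_prop
  exact ge_of_tendsto
    (hcont.continuousAt.tendsto.mono_left nhdsWithin_le_nhds : Tendsto _ (𝓝[>] δ) _)
    (eventually_mem_nhdsWithin.mono key)

/-- The empirical second moment dominates the square of the empirical mean. -/
lemma sq_mean_le_mean_sq {n : ℕ} (hn : 0 < n) (Y : Fin n → ℝ) :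
    ((1 / n : ℝ) * ∑ i, Y i) ^ 2 ≤ (1 / n : ℝ) * ∑ i, Y i ^ 2 := by
  have hn' : (0 : ℝ) < n := by exact_mod_cast hn
  have h := sq_sum_le_card_mul_sum_sq (s := Finset.univ) (f := Y)
  simp only [Finset.card_univ, Fintype.card_fin] at h
  calc ((1 / n : ℝ) * ∑ i, Y i) ^ 2 = (1 / n : ℝ) ^ 2 * (∑ i, Y i) ^ 2 := by ring
    _ ≤ (1 / n : ℝ) ^ 2 * (n * ∑ i, Y i ^ 2) := by gcongr
    _ = (1 / n : ℝ) * ∑ i, Y i ^ 2 := by field_simp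

/-- Each sample is duplicated so that a degenerate sample can be spread out symmetrically. The
perturbation `a` has mean square `δ` and increases the standard deviation by `√δ * c`. -/
lemma exists_perturbation {n : ℕ} (hn : 0 < n) (Y : Fin n → ℝ) {δ : ℝ} (hδ : 0 ≤ δ) (c m1 m2 : ℝ)
    (hm1 : m1 = (1 / n : ℝ) * ∑ i, Y i) (hm2 : m2 = (1 / n : ℝ) * ∑ i, Y i ^ 2) :
    ∃ a : Fin n × Bool → ℝ, (1 / (n * 2 : ℝ)) * ∑ k, a k ^ 2 = δ ∧
      (1 / (n * 2 : ℝ)) * ∑ k, (Y k.1 + a k * c) ^ 2 -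
        ((1 / (n * 2 : ℝ)) * ∑ k, (Y k.1 + a k * c)) ^ 2 = (√(m2 - m1 ^ 2) + √δ * c) ^ 2 := by
  have hn' : (0 : ℝ) < n := by exact_mod_cast hn
  have hS1 : ∑ i, Y i = n * m1 := by rw [hm1]; field_simp
  have hS2 : ∑ i, Y i ^ 2 = n * m2 := by rw [hm2]; field_simp
  have hS : 0 ≤ m2 - m1 ^ 2 := by
    rw [hm1, hm2]
    exact sub_nonneg.2 (sq_mean_le_mean_sq hn Y)
  have affine (α β : ℝ) : ∑ i, (α * Y i + β) = n * (α * m1 + β) := by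
    simp [Finset.sum_add_distrib, ← Finset.mul_sum, hS1]
    ring
  have affine_sq (α β : ℝ) :
      ∑ i, (α * Y i + β) ^ 2 = n * (α ^ 2 * m2 + 2 * α * β * m1 + β ^ 2) := by
    have : ∀ i, (α * Y i + β) ^ 2 = α ^ 2 * Y i ^ 2 + 2 * α * β * Y i + β ^ 2 := fun i => by ring
    simp [this, Finset.sum_add_distrib, ← Finset.mul_sum, hS1, hS2]
    ring
  rcases hS.eq_or_lt with h0 | hpos
  · refine ⟨fun k => if k.2 then √δ else -√δ, ?_, ?_⟩
    · simp [Real.sq_sqrt hδ]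
      field_simp
    · have e1 := affine 1 (√δ * c)
      have e2 := affine 1 (-√δ * c)
      have e3 := affine_sq 1 (√δ * c)
      have e4 := affine_sq 1 (-√δ * c)
      simp only [one_mul] at e1 e2 e3 e4
      simp only [Fintype.sum_prod_type, Fintype.sum_bool, if_true, Bool.false_eq_true, if_false,
        Finset.sum_add_distrib (f := fun i => (Y i + √δ * c) ^ 2),
        Finset.sum_add_distrib (f := fun i => Y i + √δ * c)]
      rw [e1, e2, e3, e4, ← h0, Real.sqrt_zero]
      field_simp
      linear_combination -4 * h0
  · set σ := √(m2 - m1 ^ 2) with hσ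
    have hσ0 : 0 < σ := Real.sqrt_pos.2 hpos
    have hσ2 : σ ^ 2 = m2 - m1 ^ 2 := Real.sq_sqrt hS
    refine ⟨fun k => √δ / σ * Y k.1 + -(√δ / σ * m1), ?_, ?_⟩
    · simp only [Fintype.sum_prod_type, Fintype.sum_bool, ← two_mul, ← Finset.mul_sum, affine_sq]
      field_simp
      rw [Real.sq_sqrt hδ]
      linear_combination -δ * hσ2
    · have hY : ∀ i, Y i + (√δ / σ * Y i + -(√δ / σ * m1)) * c =
          (1 + √δ / σ * c) * Y i + -(√δ / σ * m1) * c := fun i => by ring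
      simp only [Fintype.sum_prod_type, Fintype.sum_bool, ← two_mul, ← Finset.mul_sum, hY,
        affine, affine_sq]
      have : σ + √δ * c = (1 + √δ / σ * c) * σ := by field_simp
      rw [this, mul_pow _ σ, hσ2]
      field_simp
      ring

/-- A coupling between finitely many equally weighted points gives an upper bound on the
transport discrepancy to an empirical measure. -/
lemma Dc_uniformFamily_le {d n : ℕ} [NeZero n] {q : ℝ} (R : Fin n → Fin d → ℝ)
    (u : Fin n × Bool → Fin d → ℝ) :
    Dc (costQ q) (uniformFamily u) (empMeasure R) ≤
      ENNReal.ofReal ((1 / (n * 2 : ℝ)) *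
        ∑ k, lpNorm (ENNReal.ofReal q) (u k - R k.1) ^ 2) := by
  have hmap1 : (uniformFamily fun k => (u k, R k.1)).map Prod.fst = uniformFamily u :=
    map_uniformFamily measurable_fst _
  have hmap2 : (uniformFamily fun k : Fin n × Bool => (u k, R k.1)).map Prod.snd =
      empMeasure R := by
    rw [map_uniformFamily measurable_snd, empMeasure_eq_uniformFamily]
    exact uniformFamily_comp_fst R
  refine (iInf₂_le_of_le _ (isProbabilityMeasure_uniformFamily _)
    (iInf₂_le hmap1 hmap2)).trans_eq ?_
  rw [uniformFamily, lintegral_smul_measure, lintegral_finsetSum_measure]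
  simp only [lintegral_dirac, costQ]
  rw [← ENNReal.ofReal_sum_of_nonneg fun k _ => sq_nonneg _, ENNReal.ofReal_mul (by positivity)]
  congr 1
  rw [one_div, ENNReal.ofReal_inv_of_pos (by have := NeZero.pos n; positivity)]
  norm_num [ENNReal.ofReal_mul]

/-- Worst-case variance over the Wasserstein ball:
`sup_{D_c(P,P_n) ≤ δ} Var_P(⟨φ,R⟩) = (√(Var_{P_n}(⟨φ,R⟩)) + √δ‖φ‖_p)²`. -/
theorem stmt7 {d n : ℕ} (hn : 0 < n) (q : ℝ) (hq : 1 ≤ q) (p : ℝ≥0∞)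
    (hpq : HolderConjugate q p) (R : Fin n → Fin d → ℝ) (δ : ℝ) (hδ : 0 < δ)
    (φ : Fin d → ℝ) (hφ : ∑ i, φ i = 1) (m1 m2 : ℝ)
    (hm1 : m1 = (1 / n : ℝ) * ∑ i, ∑ j, φ j * R i j)
    (hm2 : m2 = (1 / n : ℝ) * ∑ i, (∑ j, φ j * R i j) ^ 2) :
    (⨆ (P : Measure (Fin d → ℝ)) (_ : IsProbabilityMeasure P)
        (_ : Integrable (fun r => ‖r‖ ^ 2) P)
        (_ : Dc (costQ q) P (empMeasure R) ≤ ENNReal.ofReal δ),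
        (((∫ r, (∑ i, φ i * r i) ^ 2 ∂P) - (∫ r, ∑ i, φ i * r i ∂P) ^ 2 : ℝ) : EReal)) =
      (((Real.sqrt (m2 - m1 ^ 2) + Real.sqrt δ * lpNorm p φ) ^ 2 : ℝ) : EReal) := by
  have : NeZero n := ⟨hn.ne'⟩
  have hC := lpNorm_nonneg p φ
  have hprob : IsProbabilityMeasure (empMeasure R) :=
    empMeasure_eq_uniformFamily R ▸ isProbabilityMeasure_uniformFamily R
  have hempInt : Integrable (fun r => ‖r‖ ^ 2) (empMeasure R) :=
    empMeasure_eq_uniformFamily R ▸ integrable_uniformFamily R _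
  refine le_antisymm ?_ ?_
  · refine iSup_le fun P => iSup_le fun hP => iSup_le fun hPint => iSup_le fun hPδ => ?_
    rw [EReal.coe_le_coe_iff]
    have hmain := sqrt_variance_le_of_Dc_le hpq φ hPint hempInt hδ.le hPδ
    have hvarP := ProbabilityTheory.variance_eq_sub (memLp_two_sum_mul φ hPint)
    have hvarQ := ProbabilityTheory.variance_eq_sub (memLp_two_sum_mul φ hempInt)
    have hQ : ProbabilityTheory.variance (fun r => ∑ i, φ i * r i) (empMeasure R) =
        m2 - m1 ^ 2 := by
      rw [hvarQ, empMeasure_eq_uniformFamily, integral_uniformFamily, integral_uniformFamily,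
        hm1, hm2]
      simp
    rw [hQ] at hmain
    simp only [Pi.pow_apply] at hvarP
    rw [← hvarP]
    exact (Real.sqrt_le_left (by positivity)).1 hmain
  · obtain ⟨v, hv1, hv⟩ := exists_lpNorm_le_one_sum_mul_eq hpq φ
    obtain ⟨a, ha, hvar⟩ := exists_perturbation hn (fun i => ∑ j, φ j * R i j) hδ.le
      (lpNorm p φ) m1 m2 hm1 hm2
    set u : Fin n × Bool → Fin d → ℝ := fun k => R k.1 + a k • v with hu
    have hLu (k) : ∑ j, φ j * u k j = ∑ j, φ j * R k.1 j + a k * lpNorm p φ := by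
      rw [← hv, Finset.mul_sum, ← Finset.sum_add_distrib]
      exact Finset.sum_congr rfl fun j _ => by simp [hu]; ring
    have hDc : Dc (costQ q) (uniformFamily u) (empMeasure R) ≤ ENNReal.ofReal δ := by
      refine (Dc_uniformFamily_le R u).trans (ENNReal.ofReal_le_ofReal ?_)
      rw [← ha]
      refine mul_le_mul_of_nonneg_left (Finset.sum_le_sum fun k _ => ?_) (by positivity)
      rw [hu, add_sub_cancel_left, lpNorm_smul (by linarith), mul_pow, sq_abs]
      exact mul_le_of_le_one_right (sq_nonneg _) (pow_le_one₀ (lpNorm_nonneg _ _) hv1)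
    refine le_iSup_of_le (uniformFamily u) (le_iSup_of_le (isProbabilityMeasure_uniformFamily u)
      (le_iSup_of_le (integrable_uniformFamily u _) (le_iSup_of_le hDc ?_)))
    rw [integral_uniformFamily, integral_uniformFamily, ← hvar]
    simp [hLu]
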